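/- For every integer n ≥ 1, every integer j with 0 ≤ j ≤ n, and every z ∈ ℂ, the tangential component of the Wirtinger derivative of the j-th Veronese section satisfies ⟨∂_z V̂ⱼⁿ(z), V̂ⱼⁿ(z)⟩ = ((n−2j)·conj(z)/(1+|z|²))·‖V̂ⱼⁿ(z)‖². -/

import Mathlib

open Complex Finset

/-- The `j`-th Veronese section `V̂ⱼⁿ : ℂ → ℂ^{n+1}`, whose `r`-th component is
`f_{j,r}(z) = (j!/(1+|z|²)^j)·√(binom n r)·Σ_{k=0}^{j} (−1)^k·binom r (j−k)·binom (n−r) k·z^{r−j+k}·conj(z)^k`. -/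
noncomputable def veroneseSection (n j : ℕ) (z : ℂ) : Fin (n + 1) → ℂ :=
  fun r =>
    ((j.factorial : ℂ) / (1 + (Complex.normSq z : ℂ)) ^ j) *
      (Real.sqrt (n.choose (r : ℕ)) : ℂ) *
      ∑ k ∈ Finset.range (j + 1),
        (-1 : ℂ) ^ k * ((r : ℕ).choose (j - k) : ℂ) * ((n - (r : ℕ)).choose k : ℂ) *
          z ^ ((r : ℕ) - (j - k)) * ((starRingEnd ℂ) z) ^ k

/-- The Wirtinger derivative `∂_z F = (1/2)(∂F/∂x − i·∂F/∂y)` of `F : ℂ → ℂ`, where `z = x + iy`. -/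
noncomputable def wirtingerZ (F : ℂ → ℂ) (z : ℂ) : ℂ :=
  (1 / 2 : ℂ) * (fderiv ℝ F z 1 - Complex.I * fderiv ℝ F z Complex.I)

section Wirtinger

/-- `F` is real differentiable at `z`, with Wirtinger derivative `∂_z F = a`. -/
def HasWirtingerZAt (F : ℂ → ℂ) (a z : ℂ) : Prop :=
  DifferentiableAt ℝ F z ∧ wirtingerZ F z = a

namespace HasWirtingerZAt

variable {F G : ℂ → ℂ} {a b z : ℂ}

theorem comp_hasDerivAt {φ : ℂ → ℂ} {φ' : ℂ} (hφ : HasDerivAt φ φ' (F z))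
    (hF : HasWirtingerZAt F a z) : HasWirtingerZAt (fun u => φ (F u)) (φ' * a) z := by
  have h := (hφ.hasFDerivAt.restrictScalars ℝ).comp z hF.1.hasFDerivAt
  refine ⟨h.differentiableAt, ?_⟩
  have h' : fderiv ℝ (fun u => φ (F u)) z = _ := h.fderiv
  rw [← hF.2, wirtingerZ, wirtingerZ, h']
  simp
  ring

theorem const (c z : ℂ) : HasWirtingerZAt (fun _ => c) 0 z :=
  ⟨differentiableAt_const c, by simp [wirtingerZ]⟩

theorem id (z : ℂ) : HasWirtingerZAt (fun u => u) 1 z := by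
  refine ⟨differentiableAt_fun_id, ?_⟩
  simp [wirtingerZ]
  norm_num

theorem conj (z : ℂ) : HasWirtingerZAt (fun u => (starRingEnd ℂ) u) 0 z := by
  have h : HasFDerivAt (fun u => (starRingEnd ℂ) u) (conjCLE : ℂ →L[ℝ] ℂ) z :=
    (conjCLE : ℂ →L[ℝ] ℂ).hasFDerivAt
  refine ⟨h.differentiableAt, ?_⟩
  rw [wirtingerZ, h.fderiv]
  simp

theorem mul (hF : HasWirtingerZAt F a z) (hG : HasWirtingerZAt G b z) :
    HasWirtingerZAt (fun u => F u * G u) (a * G z + F z * b) z := by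
  refine ⟨hF.1.mul hG.1, ?_⟩
  rw [← hF.2, ← hG.2, wirtingerZ, wirtingerZ, wirtingerZ, fderiv_fun_mul hF.1 hG.1]
  simp
  ring

theorem const_add (c : ℂ) (hF : HasWirtingerZAt F a z) :
    HasWirtingerZAt (fun u => c + F u) a z := by
  refine ⟨hF.1.const_add c, ?_⟩
  rw [← hF.2, wirtingerZ, wirtingerZ, fderiv_const_add]

theorem sum {ι : Type*} {s : Finset ι} {A : ι → ℂ → ℂ} {A' : ι → ℂ}
    (h : ∀ i ∈ s, HasWirtingerZAt (A i) (A' i) z) :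
    HasWirtingerZAt (fun u => ∑ i ∈ s, A i u) (∑ i ∈ s, A' i) z := by
  refine ⟨DifferentiableAt.fun_sum fun i hi => (h i hi).1, ?_⟩
  rw [wirtingerZ, fderiv_fun_sum fun i hi => (h i hi).1,
    ← Finset.sum_congr rfl fun i hi => (h i hi).2]
  simp [wirtingerZ, Finset.mul_sum, ← Finset.sum_sub_distrib]

end HasWirtingerZAt

end Wirtinger

section GeneratingPolynomial

open Polynomial

/-- The polynomial `(1 - wX)^a (X + z)^b`, whose coefficients are, up to normalization, the
components of the Veronese sections when `w = conj z`. -/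
noncomputable def veroneseGen (z w : ℂ) (a b : ℕ) : ℂ[X] :=
  (1 - C w * X) ^ a * (X + C z) ^ b

theorem coeff_one_add_C_mul_X_pow {R : Type*} [CommRing R] (c : R) (n k : ℕ) :
    ((1 + C c * X : R[X]) ^ n).coeff k = n.choose k * c ^ k := by
  have h : (1 + C c * X : R[X]) ^ n = ((1 + X) ^ n).comp (C c * X) := by simp
  rw [h, comp_C_mul_X_coeff, coeff_one_add_X_pow]

theorem coeff_veroneseGen (z w : ℂ) (a b j : ℕ) :
    (veroneseGen z w a b).coeff j =
      ∑ k ∈ Finset.range (j + 1),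
        (-1 : ℂ) ^ k * (b.choose (j - k) : ℂ) * (a.choose k : ℂ) * z ^ (b - (j - k)) * w ^ k := by
  have h : (1 - C w * X : ℂ[X]) = 1 + C (-w) * X := by simp [sub_eq_add_neg]
  rw [veroneseGen, h, coeff_mul, Finset.Nat.sum_antidiagonal_eq_sum_range_succ_mk]
  refine Finset.sum_congr rfl fun k _ => ?_
  rw [coeff_one_add_C_mul_X_pow, coeff_X_add_C_pow, neg_pow]
  ring

theorem coeff_coeff_map_C_mul_C {R : Type*} [CommRing R] (p q : R[X]) (i j : ℕ) :
    ((p.map C * C q).coeff i).coeff j = p.coeff i * q.coeff j := by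
  rw [coeff_mul_C, coeff_map, coeff_C_mul]

theorem sum_choose_mul_coeff_veroneseGen (z w : ℂ) (n i j : ℕ) (h : ℂ[X]) :
    ∑ r ∈ Finset.range (n + 1), (n.choose r : ℂ) * (veroneseGen z w (n - r) r).coeff i *
        (h * veroneseGen w z (n - r) r).coeff j =
      (1 + z * w) ^ n * n.choose i * (h * X ^ i).coeff j := by
  have key : ∑ r ∈ Finset.range (n + 1), (n.choose r : ℂ[X][X]) *
      ((veroneseGen z w (n - r) r).map C * C (h * veroneseGen w z (n - r) r)) =
      C (C ((1 + z * w) ^ n) * h) * (1 + C X * X) ^ n := by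
    have e : (C (C (1 + z * w)) * (1 + C X * X) : ℂ[X][X]) =
        (X + C (C z)) * (C X + C (C w)) + (1 - C (C w) * X) * (1 - C (C z) * C X) := by
      simp only [map_add, map_mul, map_one]
      ring
    have e' : (C (C ((1 + z * w) ^ n) * h) * (1 + C X * X) ^ n : ℂ[X][X]) =
        C h * (C (C (1 + z * w)) * (1 + C X * X)) ^ n := by
      rw [mul_pow, map_mul, map_pow, map_pow]
      ring
    rw [e', e, add_pow, Finset.mul_sum]
    refine Finset.sum_congr rfl fun r _ => ?_
    simp only [veroneseGen, Polynomial.map_mul, Polynomial.map_pow, Polynomial.map_sub,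
      Polynomial.map_add, Polynomial.map_one, map_X, map_C, map_mul, map_pow, map_sub, map_add,
      map_one, mul_pow]
    ring
  have key' := congrArg (fun p : ℂ[X][X] => (p.coeff i).coeff j) key
  simp only [finsetSum_coeff] at key'
  rw [coeff_C_mul, coeff_one_add_C_mul_X_pow] at key'
  have e : C ((1 + z * w) ^ n) * h * ((n.choose i : ℂ[X]) * X ^ i) =
      C ((1 + z * w) ^ n * n.choose i) * (h * X ^ i) := by
    rw [map_mul, map_natCast]
    ring
  rw [e, coeff_C_mul] at key'
  rw [← key']
  refine Finset.sum_congr rfl fun r _ => ?_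
  rw [← C_eq_natCast, coeff_C_mul, ← C_eq_natCast, coeff_C_mul, coeff_coeff_map_C_mul_C, mul_assoc]

theorem sum_choose_mul_coeff_veroneseGen_self (z w : ℂ) (n j : ℕ) :
    ∑ r ∈ Finset.range (n + 1), (n.choose r : ℂ) * (veroneseGen z w (n - r) r).coeff j *
        (veroneseGen w z (n - r) r).coeff j = (1 + z * w) ^ n * n.choose j := by
  simpa using sum_choose_mul_coeff_veroneseGen z w n j j 1

/-- Here `r * veroneseGen z w (n - r) (r - 1)` is the derivative of `veroneseGen z w (n - r) r`
with respect to `z`. -/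
theorem sum_choose_mul_coeff_deriv_veroneseGen (z w : ℂ) (n j : ℕ) :
    (1 + z * w) * ∑ r ∈ Finset.range (n + 1), (n.choose r : ℂ) *
        (r * (veroneseGen z w (n - r) (r - 1)).coeff j) * (veroneseGen w z (n - r) r).coeff j =
      (n - j) * w * ((1 + z * w) ^ n * n.choose j) := by
  obtain _ | m := n
  · rcases j with _ | j <;> simp
  have hcoeff : ((X + C w) * X ^ j : ℂ[X]).coeff j = w := by
    rw [add_mul, coeff_add, ← pow_succ', coeff_X_pow, coeff_C_mul, coeff_X_pow]
    simp
  have hs := sum_choose_mul_coeff_veroneseGen z w m j j (X + C w)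
  rw [hcoeff] at hs
  have hchoose : ((m : ℂ) + 1) * m.choose j = (m + 1 - j) * (m + 1).choose j := by
    rcases le_or_gt j (m + 1) with hj | hj
    · have := Nat.choose_mul_succ_eq m j
      have h2 := congrArg (Nat.cast : ℕ → ℂ) this
      push_cast [Nat.cast_sub hj] at h2
      linear_combination h2
    · rw [Nat.choose_eq_zero_of_lt hj, Nat.choose_eq_zero_of_lt (by omega)]
      simp
  have hsum : ∑ r ∈ Finset.range (m + 1 + 1), ((m + 1).choose r : ℂ) *
        (r * (veroneseGen z w (m + 1 - r) (r - 1)).coeff j) *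
          (veroneseGen w z (m + 1 - r) r).coeff j =
      (m + 1) * ((1 + z * w) ^ m * m.choose j * w) := by
    rw [Finset.sum_range_succ', ← hs, Finset.mul_sum]
    simp only [Nat.cast_zero, zero_mul, mul_zero, add_zero]
    refine Finset.sum_congr rfl fun r _ => ?_
    have hg : veroneseGen w z (m - r) (r + 1) = (X + C w) * veroneseGen w z (m - r) r := by
      simp only [veroneseGen]
      ring
    have hc := congrArg (Nat.cast : ℕ → ℂ) (Nat.add_one_mul_choose_eq m r)
    push_cast at hc
    rw [Nat.add_sub_add_right, Nat.add_sub_cancel, hg]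
    push_cast
    linear_combination -((veroneseGen z w (m - r) r).coeff j *
      ((X + C w) * veroneseGen w z (m - r) r).coeff j) * hc
  rw [hsum]
  push_cast
  linear_combination (1 + z * w) ^ (m + 1) * w * hchoose

theorem hasWirtingerZAt_coeff_veroneseGen (z : ℂ) (a b j : ℕ) :
    HasWirtingerZAt (fun u => (veroneseGen u ((starRingEnd ℂ) u) a b).coeff j)
      (b * (veroneseGen z ((starRingEnd ℂ) z) a (b - 1)).coeff j) z := by
  simp only [coeff_veroneseGen]
  rw [Finset.mul_sum]
  refine HasWirtingerZAt.sum fun k _ => ?_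
  have h := ((HasWirtingerZAt.const ((-1 : ℂ) ^ k * (b.choose (j - k) : ℂ) * (a.choose k : ℂ)) z).mul
    ((HasWirtingerZAt.id z).comp_hasDerivAt (hasDerivAt_pow (b - (j - k)) z))).mul
    ((HasWirtingerZAt.conj z).comp_hasDerivAt (hasDerivAt_pow k ((starRingEnd ℂ) z)))
  convert h using 1
  have hc : (b : ℂ) * (b - 1).choose (j - k) = b.choose (j - k) * (b - (j - k) : ℕ) := by
    rcases b with _ | b
    · simp
    · have := Nat.choose_mul_succ_eq b (j - k)
      rw [Nat.add_sub_cancel]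
      exact_mod_cast (mul_comm _ _).trans this
  rw [show b - 1 - (j - k) = b - (j - k) - 1 by omega]
  linear_combination (-1 : ℂ) ^ k * a.choose k * z ^ (b - (j - k) - 1) *
    ((starRingEnd ℂ) z) ^ k * hc

theorem conj_coeff_veroneseGen (z : ℂ) (a b j : ℕ) :
    (starRingEnd ℂ) ((veroneseGen z ((starRingEnd ℂ) z) a b).coeff j) =
      (veroneseGen ((starRingEnd ℂ) z) z a b).coeff j := by
  simp [coeff_veroneseGen]

theorem veroneseSection_eq_coeff_veroneseGen (n j : ℕ) (z : ℂ) (r : Fin (n + 1)) :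
    veroneseSection n j z r =
      ((j.factorial : ℂ) / (1 + z * (starRingEnd ℂ) z) ^ j) * (Real.sqrt (n.choose (r : ℕ)) : ℂ) *
        (veroneseGen z ((starRingEnd ℂ) z) (n - r) r).coeff j := by
  rw [veroneseSection, coeff_veroneseGen, mul_conj]

end GeneratingPolynomial

theorem one_add_mul_conj_ne_zero (z : ℂ) : 1 + z * (starRingEnd ℂ) z ≠ 0 := by
  rw [mul_conj]
  have h : 0 < 1 + normSq z := by linarith [normSq_nonneg z]
  exact_mod_cast h.ne'

theorem hasWirtingerZAt_veroneseSection (n j : ℕ) (z : ℂ) (r : Fin (n + 1)) :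
    HasWirtingerZAt (fun u => veroneseSection n j u r)
      (((j.factorial : ℂ) / (1 + z * (starRingEnd ℂ) z) ^ j) *
        (Real.sqrt (n.choose (r : ℕ)) : ℂ) *
        (r * (veroneseGen z ((starRingEnd ℂ) z) (n - r) (r - 1)).coeff j -
          j * (starRingEnd ℂ) z / (1 + z * (starRingEnd ℂ) z) *
            (veroneseGen z ((starRingEnd ℂ) z) (n - r) r).coeff j)) z := by
  simp only [veroneseSection_eq_coeff_veroneseGen]
  have hD := one_add_mul_conj_ne_zero z
  have hpow := ((hasDerivAt_pow j (1 + z * (starRingEnd ℂ) z)).fun_inv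
    (pow_ne_zero j hD)).const_mul (j.factorial : ℂ)
  have hden := HasWirtingerZAt.const_add 1 ((HasWirtingerZAt.id z).mul (HasWirtingerZAt.conj z))
  have h := ((HasWirtingerZAt.comp_hasDerivAt (F := fun u => 1 + u * (starRingEnd ℂ) u)
    hpow hden).mul
    (HasWirtingerZAt.const (Real.sqrt (n.choose (r : ℕ)) : ℂ) z)).mul
      (hasWirtingerZAt_coeff_veroneseGen z (n - r) r j)
  simp only [← div_eq_mul_inv] at h
  convert h using 1
  rcases j with _ | j
  · simp
  · rw [Nat.add_sub_cancel]
    field_simp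
    ring

/-- For `n ≥ 1`, `0 ≤ j ≤ n` and `z ∈ ℂ`, the tangential component of the Wirtinger derivative
of the `j`-th Veronese section satisfies
`⟨∂_z V̂ⱼⁿ(z), V̂ⱼⁿ(z)⟩ = ((n−2j)·conj(z)/(1+|z|²))·‖V̂ⱼⁿ(z)‖²`,
where `⟨v,w⟩ = Σ_r v_r·conj(w_r)`. -/
theorem veronese_section_tangential_derivative (n j : ℕ) (hn : 1 ≤ n) (hj : j ≤ n) (z : ℂ) :
    ∑ r, wirtingerZ (fun w => veroneseSection n j w r) z *
        (starRingEnd ℂ) (veroneseSection n j z r) =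
      (((n : ℂ) - 2 * j) * (starRingEnd ℂ) z / (1 + (Complex.normSq z : ℂ))) *
        ((∑ r, Complex.normSq (veroneseSection n j z r) : ℝ) : ℂ) := by
  have hD := one_add_mul_conj_ne_zero z
  have hconj (r : Fin (n + 1)) : (starRingEnd ℂ) (veroneseSection n j z r) =
      ((j.factorial : ℂ) / (1 + z * (starRingEnd ℂ) z) ^ j) *
        (Real.sqrt (n.choose (r : ℕ)) : ℂ) *
        (veroneseGen ((starRingEnd ℂ) z) z (n - r) r).coeff j := by
    rw [veroneseSection_eq_coeff_veroneseGen, map_mul, conj_coeff_veroneseGen]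
    simp [mul_comm]
  have hsqrt (r : ℕ) : (Real.sqrt (n.choose r) : ℂ) * (Real.sqrt (n.choose r) : ℂ) =
      n.choose r := by
    rw [← ofReal_mul, Real.mul_self_sqrt (Nat.cast_nonneg _), ofReal_natCast]
  have hself := sum_choose_mul_coeff_veroneseGen_self z ((starRingEnd ℂ) z) n j
  have hderiv := sum_choose_mul_coeff_deriv_veroneseGen z ((starRingEnd ℂ) z) n j
  rw [← hself] at hderiv
  rw [← Fin.sum_univ_eq_sum_range (fun r => (n.choose r : ℂ) *
    (r * (veroneseGen z ((starRingEnd ℂ) z) (n - r) (r - 1)).coeff j) *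
      (veroneseGen ((starRingEnd ℂ) z) z (n - r) r).coeff j),
    ← Fin.sum_univ_eq_sum_range (fun r => (n.choose r : ℂ) *
    (veroneseGen z ((starRingEnd ℂ) z) (n - r) r).coeff j *
      (veroneseGen ((starRingEnd ℂ) z) z (n - r) r).coeff j)] at hderiv
  set D := 1 + z * (starRingEnd ℂ) z with hDdef
  set K := (j.factorial : ℂ) / D ^ j with hK
  set S := ∑ r : Fin (n + 1), (n.choose r : ℂ) *
    (veroneseGen z ((starRingEnd ℂ) z) (n - r) r).coeff j *
      (veroneseGen ((starRingEnd ℂ) z) z (n - r) r).coeff j with hS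
  set T := ∑ r : Fin (n + 1), (n.choose r : ℂ) *
    (r * (veroneseGen z ((starRingEnd ℂ) z) (n - r) (r - 1)).coeff j) *
      (veroneseGen ((starRingEnd ℂ) z) z (n - r) r).coeff j with hT
  have hnorm : ((∑ r, Complex.normSq (veroneseSection n j z r) : ℝ) : ℂ) = K ^ 2 * S := by
    rw [ofReal_sum, hS, Finset.mul_sum]
    refine Finset.sum_congr rfl fun r _ => ?_
    rw [← mul_conj, hconj, veroneseSection_eq_coeff_veroneseGen, ← hsqrt]
    ring
  have hlhs : ∑ r, wirtingerZ (fun w => veroneseSection n j w r) z *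
      (starRingEnd ℂ) (veroneseSection n j z r) =
      K ^ 2 * (T - j * (starRingEnd ℂ) z / D * S) := by
    rw [hT, hS, Finset.mul_sum, ← Finset.sum_sub_distrib, Finset.mul_sum]
    refine Finset.sum_congr rfl fun r _ => ?_
    rw [hconj, (hasWirtingerZAt_veroneseSection n j z r).2, ← hsqrt]
    ring
  have hTS : T = (n - j) * (starRingEnd ℂ) z * S / D := by
    rw [eq_div_iff hD, mul_comm, hderiv]
  rw [hlhs, hnorm, ← mul_conj, ← hDdef, hTS]
  ring
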